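/- arXiv:2308.16366 — 2 statements merged into one kernel-verified Lean document; each statement's English description precedes it below -/
import Mathlib

section
/- Let W̃ = W̃(m1,m2) with m1 odd, and let ℓ2 be an odd integer with 0 < ℓ2 < 2m2. The assignments f1 ↦ diag(1,−1), f2 ↦ [[0,1],[1,0]], r1 ↦ −Id₂, r2 ↦ diag(ζ2^{ℓ2}, ζ2^{−ℓ2}), z ↦ −Id₂ respect all defining relations of W̃ and hence define a 2-dimensional representation U(m1, ℓ2) : W̃ → GL(ℂ²) on which z acts as −Id; moreover this representation is irreducible. -/
namespace Stmt8

/-- Generators of the double cover `W̃(m1, m2)`. -/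
inductive Gen | z | r1 | f1 | r2 | f2

open FreeGroup in
/-- Defining relations of `W̃(m1, m2)`:
`r1^{m1} = z`, `r2^{m2} = z`, `f1^2 = 1`, `f2^2 = 1`, `(r1 f1)^2 = 1`, `(r2 f2)^2 = 1`,
`r1 r2 = r2 r1`, `r1 f2 = f2 r1`, `r2 f1 = f1 r2`, `(f1 f2)^2 = z`, `z^2 = 1`. -/
def rels (m1 m2 : ℕ) : Set (FreeGroup Gen) :=
  { of Gen.r1 ^ m1 * (of Gen.z)⁻¹,
    of Gen.r2 ^ m2 * (of Gen.z)⁻¹,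
    of Gen.f1 ^ 2,
    of Gen.f2 ^ 2,
    (of Gen.r1 * of Gen.f1) ^ 2,
    (of Gen.r2 * of Gen.f2) ^ 2,
    of Gen.r1 * of Gen.r2 * (of Gen.r2 * of Gen.r1)⁻¹,
    of Gen.r1 * of Gen.f2 * (of Gen.f2 * of Gen.r1)⁻¹,
    of Gen.r2 * of Gen.f1 * (of Gen.f1 * of Gen.r2)⁻¹,
    (of Gen.f1 * of Gen.f2) ^ 2 * (of Gen.z)⁻¹,
    of Gen.z ^ 2 }

/-- The double cover `W̃(m1, m2)` of `D_{2m1} × D_{2m2}`, as a presented group. -/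
abbrev Wt (m1 m2 : ℕ) := PresentedGroup (rels m1 m2)

def wz (m1 m2 : ℕ) : Wt m1 m2 := PresentedGroup.of Gen.z
def wr1 (m1 m2 : ℕ) : Wt m1 m2 := PresentedGroup.of Gen.r1
def wf1 (m1 m2 : ℕ) : Wt m1 m2 := PresentedGroup.of Gen.f1
def wr2 (m1 m2 : ℕ) : Wt m1 m2 := PresentedGroup.of Gen.r2
def wf2 (m1 m2 : ℕ) : Wt m1 m2 := PresentedGroup.of Gen.f2

/-- `ζ m = exp(i π / m)`. -/
noncomputable def ζ (m : ℕ) : ℂ := Complex.exp (Real.pi * Complex.I / m)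

/-- Irreducibility of a 2-dimensional matrix representation of `W̃(m1,m2)`. -/
def Irreducible2 {m1 m2 : ℕ} (ρ : Wt m1 m2 →* GL (Fin 2) ℂ) : Prop :=
  ∀ p : Submodule ℂ (Fin 2 → ℂ),
    (∀ w : Wt m1 m2, ∀ v ∈ p, Matrix.mulVec (ρ w : Matrix (Fin 2) (Fin 2) ℂ) v ∈ p) →
    p = ⊥ ∨ p = ⊤

/-- The reflection `diag(1, -1)` as an invertible matrix. -/
def signReflection : GL (Fin 2) ℂ where
  val := !![1, 0; 0, -1]
  inv := !![1, 0; 0, -1]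
  val_inv := by simp [Matrix.one_fin_two]
  inv_val := by simp [Matrix.one_fin_two]

/-- The reflection swapping the two coordinates as an invertible matrix. -/
def swapReflection : GL (Fin 2) ℂ where
  val := !![0, 1; 1, 0]
  inv := !![0, 1; 1, 0]
  val_inv := by simp [Matrix.one_fin_two]
  inv_val := by simp [Matrix.one_fin_two]

/-- The invertible matrix `diag(a, a⁻¹)`. -/
def diagInv (a : ℂˣ) : GL (Fin 2) ℂ where
  val := Matrix.diagonal ![(a : ℂ), (a⁻¹ : ℂˣ)]
  inv := Matrix.diagonal ![((a⁻¹ : ℂˣ) : ℂ), a]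
  val_inv := by
    rw [Matrix.diagonal_mul_diagonal, ← Matrix.diagonal_one]
    congr 1; ext i; fin_cases i <;> simp
  inv_val := by
    rw [Matrix.diagonal_mul_diagonal, ← Matrix.diagonal_one]
    congr 1; ext i; fin_cases i <;> simp

theorem diagInv_pow_eq_neg_one {a : ℂˣ} {m : ℕ} (ha : a ^ m = -1) : diagInv a ^ m = -1 := by
  have ha' : (a : ℂ) ^ m = -1 := by simpa using congrArg Units.val ha
  ext i j
  fin_cases i <;> fin_cases j <;>
    simp [diagInv, Matrix.diagonal_pow, ha']

theorem ζ_ne_zero (m : ℕ) : ζ m ≠ 0 := Complex.exp_ne_zero _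

theorem ζ_pow_self {m : ℕ} (hm : m ≠ 0) : ζ m ^ m = -1 := by
  have hm' : (m : ℂ) ≠ 0 := by exact_mod_cast hm
  rw [ζ, ← Complex.exp_nat_mul, mul_div_cancel₀ _ hm', Complex.exp_pi_mul_I]

theorem ζ_zpow_pow_self {m : ℕ} (hm : m ≠ 0) {l : ℤ} (hl : Odd l) : (ζ m ^ l) ^ m = -1 := by
  rw [← zpow_natCast, zpow_comm, zpow_natCast, ζ_pow_self hm, hl.neg_one_zpow]

/-- The images of the generators of `W̃(m1, m2)` when `r2` acts by `diag(a, a⁻¹)`. -/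
def genImage (a : ℂˣ) : Gen → GL (Fin 2) ℂ
  | .z => -1
  | .r1 => -1
  | .f1 => signReflection
  | .r2 => diagInv a
  | .f2 => swapReflection

theorem genImage_respects_rels {m1 m2 : ℕ} (hm1 : Odd m1) {a : ℂˣ} (ha : a ^ m2 = -1) :
    ∀ r ∈ rels m1 m2, FreeGroup.lift (genImage a) r = 1 := by
  have hf1 : signReflection ^ 2 = 1 := by
    ext i j; fin_cases i <;> fin_cases j <;> simp [signReflection, sq]
  have hf2 : swapReflection ^ 2 = 1 := by
    ext i j; fin_cases i <;> fin_cases j <;> simp [swapReflection, sq]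
  have hr2f2 : (diagInv a * swapReflection) ^ 2 = 1 := by
    ext i j
    fin_cases i <;> fin_cases j <;>
      simp [diagInv, swapReflection, sq, Matrix.mul_apply, Fin.sum_univ_two]
  have hr2f1 : diagInv a * signReflection = signReflection * diagInv a := by
    ext i j
    fin_cases i <;> fin_cases j <;>
      simp [diagInv, signReflection, Matrix.mul_apply, Fin.sum_univ_two]
  have hf1f2 : (signReflection * swapReflection) ^ 2 = -1 := by
    ext i j; fin_cases i <;> fin_cases j <;> simp [signReflection, swapReflection, sq]
  intro r hr
  simp only [rels, Set.mem_insert_iff, Set.mem_singleton_iff] at hr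
  rcases hr with rfl | rfl | rfl | rfl | rfl | rfl | rfl | rfl | rfl | rfl | rfl <;>
    simp only [map_mul, map_pow, map_inv, FreeGroup.lift_apply_of, genImage, mul_inv_eq_one]
  · exact hm1.neg_one_pow
  · exact diagInv_pow_eq_neg_one ha
  · exact hf1
  · exact hf2
  · simpa using hf1
  · exact hr2f2
  · simp
  · simp
  · exact hr2f1
  · exact hf1f2
  · simp

/-- A subspace of `ℂ²` stable under `diag(1, -1)` and the coordinate swap is trivial. -/
theorem eq_bot_or_eq_top_of_reflections_stable (p : Submodule ℂ (Fin 2 → ℂ))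
    (h_sign : ∀ v ∈ p, Matrix.mulVec !![1, 0; 0, -1] v ∈ p)
    (h_swap : ∀ v ∈ p, Matrix.mulVec !![0, 1; 1, 0] v ∈ p) : p = ⊥ ∨ p = ⊤ := by
  replace h_sign : ∀ v ∈ p, ![v 0, -v 1] ∈ p := fun v hv => by
    convert h_sign v hv using 1
    ext i
    fin_cases i <;> simp [Matrix.mulVec_eq_sum, Fin.sum_univ_two]
  replace h_swap : ∀ v ∈ p, ![v 1, v 0] ∈ p := fun v hv => by
    convert h_swap v hv using 1
    ext i
    fin_cases i <;> simp [Matrix.mulVec_eq_sum, Fin.sum_univ_two]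
  have h_top : ∀ v ∈ p, v 0 ≠ 0 → p = ⊤ := by
    intro v hv hv0
    have he0 : ![1, 0] ∈ p := by
      have h := p.smul_mem (2 * v 0)⁻¹ (p.add_mem hv (h_sign v hv))
      convert h using 1
      ext i
      fin_cases i
      · simp [-Matrix.add_cons]
        field_simp
        norm_num
      · simp [-Matrix.add_cons]
    have he1 : ![0, 1] ∈ p := by
      simpa using h_swap _ he0
    refine eq_top_iff.2 fun w _ => ?_
    have h := p.add_mem (p.smul_mem (w 0) he0) (p.smul_mem (w 1) he1)
    convert h using 1
    ext i
    fin_cases i <;> simp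
  refine or_iff_not_imp_left.2 fun hp => ?_
  obtain ⟨v, hv, hv0⟩ := p.ne_bot_iff.1 hp
  by_cases h0 : v 0 = 0
  · refine h_top _ (h_swap v hv) fun h => hv0 ?_
    ext i
    fin_cases i
    · exact h0
    · simpa using h
  · exact h_top v hv h0

/-- For `m1` odd and `ℓ2` odd with `0 < ℓ2 < 2 m2`, the assignments
`f1 ↦ diag(1,−1)`, `f2 ↦ [[0,1],[1,0]]`, `r1 ↦ −Id`, `r2 ↦ diag(ζ2^{ℓ2}, ζ2^{−ℓ2})`,
`z ↦ −Id` respect the defining relations of `W̃(m1,m2)` and define a 2-dimensional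
representation `U(m1, ℓ2)` on which `z` acts as `−Id`; moreover it is irreducible. -/
theorem U2_first_exists_and_irreducible (m1 m2 : ℕ) (h1 : 1 ≤ m1) (h2 : 1 ≤ m2)
    (hm1 : Odd m1) (ℓ2 : ℤ) (hodd2 : Odd ℓ2) (hr2 : 0 < ℓ2) (hr2m : ℓ2 < 2 * m2) :
    ∃ ρ : Wt m1 m2 →* GL (Fin 2) ℂ,
      (ρ (wf1 m1 m2) : Matrix (Fin 2) (Fin 2) ℂ) = !![1, 0; 0, -1] ∧
      (ρ (wf2 m1 m2) : Matrix (Fin 2) (Fin 2) ℂ) = !![0, 1; 1, 0] ∧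
      (ρ (wr1 m1 m2) : Matrix (Fin 2) (Fin 2) ℂ) = -1 ∧
      (ρ (wr2 m1 m2) : Matrix (Fin 2) (Fin 2) ℂ)
        = Matrix.diagonal ![ζ m2 ^ ℓ2, ζ m2 ^ (-ℓ2)] ∧
      (ρ (wz m1 m2) : Matrix (Fin 2) (Fin 2) ℂ) = -1 ∧
      Irreducible2 ρ := by
  have hm2 : m2 ≠ 0 := Nat.one_le_iff_ne_zero.1 h2
  let a : ℂˣ := Units.mk0 (ζ m2 ^ ℓ2) (zpow_ne_zero _ (ζ_ne_zero m2))
  have ha : a ^ m2 = -1 := by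
    ext
    simpa [a] using ζ_zpow_pow_self hm2 hodd2
  let ρ : Wt m1 m2 →* GL (Fin 2) ℂ := PresentedGroup.toGroup (genImage_respects_rels hm1 ha)
  have hρ (g : Gen) : ρ (PresentedGroup.of g) = genImage a g := PresentedGroup.toGroup.of _
  have hf1 : (ρ (wf1 m1 m2) : Matrix (Fin 2) (Fin 2) ℂ) = !![1, 0; 0, -1] :=
    congrArg Units.val (hρ Gen.f1)
  have hf2 : (ρ (wf2 m1 m2) : Matrix (Fin 2) (Fin 2) ℂ) = !![0, 1; 1, 0] :=
    congrArg Units.val (hρ Gen.f2)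
  refine ⟨ρ, hf1, hf2, congrArg Units.val (hρ Gen.r1), ?_, congrArg Units.val (hρ Gen.z), ?_⟩
  · rw [wr2, hρ, zpow_neg]
    simp [genImage, diagInv, a]
  · intro p hp
    refine eq_bot_or_eq_top_of_reflections_stable p ?_ ?_
    · simpa only [hf1] using hp (wf1 m1 m2)
    · simpa only [hf2] using hp (wf2 m1 m2)

end Stmt8
end

section
/- With W, 𝒞 and O(x) as defined in the context, for every x ∈ ℂ⁴, every 1 ≤ p ≤ m1 and every 1 ≤ q ≤ m2, one has in (MonoidAlgebra ℂ W) ⊗ 𝒞 the equivariance relations (s_p ⊗ ι(α_p))·O(x) = −O(s_p·x)·(s_p ⊗ ι(α_p)) and (t_q ⊗ ι(β_q))·O(x) = −O(t_q·x)·(t_q ⊗ ι(β_q)), where s_p·x and t_q·x denote matrix–vector multiplication. -/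
namespace Stmt18

/-- The quadratic form `Q(x) = x1² + x2² + x3² + x4²` on `ℂ⁴`. -/
noncomputable def Q4 : QuadraticForm ℂ (Fin 4 → ℂ) :=
  QuadraticMap.weightedSumSquares ℂ (fun _ : Fin 4 => (1 : ℂ))

/-- The Clifford algebra `𝒞` of `Q4`. -/
abbrev Cl := CliffordAlgebra Q4

/-- The canonical generators `e_j = ι(standard basis vector)` of `𝒞`. -/
noncomputable def eC (j : Fin 4) : Cl := CliffordAlgebra.ι Q4 (Pi.single j 1)

/-- `θ_a = (e_{2a−1} + i e_{2a})/2` for `a ∈ {1,2}` (0-indexed `a : Fin 2`). -/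
noncomputable def θ (a : Fin 2) : Cl :=
  (2 : ℂ)⁻¹ • (eC ⟨2 * a.val, by have := a.isLt; omega⟩
    + Complex.I • eC ⟨2 * a.val + 1, by have := a.isLt; omega⟩)

/-- `θ̄_a = (e_{2a−1} − i e_{2a})/2` for `a ∈ {1,2}` (0-indexed `a : Fin 2`). -/
noncomputable def θbar (a : Fin 2) : Cl :=
  (2 : ℂ)⁻¹ • (eC ⟨2 * a.val, by have := a.isLt; omega⟩
    - Complex.I • eC ⟨2 * a.val + 1, by have := a.isLt; omega⟩)

open scoped TensorProduct

/-- The reflection `s_p ∈ D_{2m1} ⊂ O(4)` acting on the first two coordinates. -/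
noncomputable def sMat (m1 : ℕ) (p : ℕ) : Matrix (Fin 4) (Fin 4) ℂ :=
  !![(Real.cos (2 * p * Real.pi / m1) : ℂ), (Real.sin (2 * p * Real.pi / m1) : ℂ), 0, 0;
     (Real.sin (2 * p * Real.pi / m1) : ℂ), -(Real.cos (2 * p * Real.pi / m1) : ℂ), 0, 0;
     0, 0, 1, 0;
     0, 0, 0, 1]

/-- The reflection `t_q ∈ D_{2m2} ⊂ O(4)` acting on the last two coordinates. -/
noncomputable def tMat (m2 : ℕ) (q : ℕ) : Matrix (Fin 4) (Fin 4) ℂ :=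
  !![1, 0, 0, 0;
     0, 1, 0, 0;
     0, 0, (Real.cos (2 * q * Real.pi / m2) : ℂ), (Real.sin (2 * q * Real.pi / m2) : ℂ);
     0, 0, (Real.sin (2 * q * Real.pi / m2) : ℂ), -(Real.cos (2 * q * Real.pi / m2) : ℂ)]

/-- The root `α_p = (sin(pπ/m1), −cos(pπ/m1), 0, 0)`. -/
noncomputable def αv (m1 : ℕ) (p : ℕ) : Fin 4 → ℂ :=
  ![(Real.sin (p * Real.pi / m1) : ℂ), -(Real.cos (p * Real.pi / m1) : ℂ), 0, 0]

/-- The root `β_q = (0, 0, sin(qπ/m2), −cos(qπ/m2))`. -/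
noncomputable def βv (m2 : ℕ) (q : ℕ) : Fin 4 → ℂ :=
  ![0, 0, (Real.sin (q * Real.pi / m2) : ℂ), -(Real.cos (q * Real.pi / m2) : ℂ)]

/-- The subgroup `W ⊆ GL₄(ℂ)` generated by the reflections `s_p` (`1 ≤ p ≤ m1`)
and `t_q` (`1 ≤ q ≤ m2`). -/
noncomputable def Wgrp (m1 m2 : ℕ) : Subgroup (GL (Fin 4) ℂ) :=
  Subgroup.closure {A : GL (Fin 4) ℂ |
    (∃ p, 1 ≤ p ∧ p ≤ m1 ∧ (A : Matrix (Fin 4) (Fin 4) ℂ) = sMat m1 p) ∨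
    (∃ q, 1 ≤ q ∧ q ≤ m2 ∧ (A : Matrix (Fin 4) (Fin 4) ℂ) = tMat m2 q)}

/-- The bilinear form `B(x,y) = Σ_j x_j y_j`. -/
noncomputable def Bform (x y : Fin 4 → ℂ) : ℂ := ∑ j, x j * y j

/-- The one-index symmetry
`O(x) = Σ_p κ_{α_p} B(x,α_p) (s_p ⊗ ι(α_p)) + Σ_q κ_{β_q} B(x,β_q) (t_q ⊗ ι(β_q))`
in `ℂ[W] ⊗ 𝒞`. -/
noncomputable def Osym (m1 m2 : ℕ) (κα κβ : ℕ → ℂ)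
    (s t : ℕ → (Wgrp m1 m2)) (x : Fin 4 → ℂ) :
    MonoidAlgebra ℂ (Wgrp m1 m2) ⊗[ℂ] Cl :=
  (∑ p ∈ Finset.Icc 1 m1, (κα p * Bform x (αv m1 p)) •
      (MonoidAlgebra.of ℂ (Wgrp m1 m2) (s p) ⊗ₜ[ℂ] CliffordAlgebra.ι Q4 (αv m1 p)))
  + ∑ q ∈ Finset.Icc 1 m2, (κβ q * Bform x (βv m2 q)) •
      (MonoidAlgebra.of ℂ (Wgrp m1 m2) (t q) ⊗ₜ[ℂ] CliffordAlgebra.ι Q4 (βv m2 q))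

theorem Bform_comm (x y : Fin 4 → ℂ) : Bform x y = Bform y x := by
  simp only [Bform, mul_comm]

theorem Bform_sub_left (x y z : Fin 4 → ℂ) : Bform (x - y) z = Bform x z - Bform y z := by
  simp only [Bform, Pi.sub_apply, sub_mul, Finset.sum_sub_distrib]

theorem Bform_smul_left (c : ℂ) (x y : Fin 4 → ℂ) : Bform (c • x) y = c * Bform x y := by
  simp only [Bform, Pi.smul_apply, smul_eq_mul, mul_assoc, Finset.mul_sum]

theorem Bform_sub_right (x y z : Fin 4 → ℂ) : Bform x (y - z) = Bform x y - Bform x z := by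
  simp only [Bform, Pi.sub_apply, mul_sub, Finset.sum_sub_distrib]

theorem Bform_smul_right (c : ℂ) (x y : Fin 4 → ℂ) : Bform x (c • y) = c * Bform x y := by
  rw [Bform_comm, Bform_smul_left, Bform_comm]

theorem Q4_apply (x : Fin 4 → ℂ) : Q4 x = Bform x x := by
  simp [Q4, Bform, QuadraticMap.weightedSumSquares_apply]

theorem polar_Q4 (x y : Fin 4 → ℂ) : QuadraticMap.polar Q4 x y = 2 * Bform x y := by
  simp only [QuadraticMap.polar, Q4_apply, Bform, Fin.sum_univ_four, Pi.add_apply]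
  ring

/-- `M` is the matrix of the orthogonal reflection in the unit vector `u`. -/
def IsReflection (M : Matrix (Fin 4) (Fin 4) ℂ) (u : Fin 4 → ℂ) : Prop :=
  Bform u u = 1 ∧ ∀ x, M.mulVec x = x - (2 * Bform x u) • u

theorem IsReflection.mul_eq {M N N' : Matrix (Fin 4) (Fin 4) ℂ} {u v v' : Fin 4 → ℂ} {ε : ℂ}
    (hM : IsReflection M u) (hN : IsReflection N v) (hN' : IsReflection N' v')
    (hε : ε * ε = 1) (hv : v' = ε • ((2 * Bform u v) • u - v)) :
    M * N = N' * M := by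
  refine Matrix.ext_of_mulVec_single fun i => ?_
  generalize (Pi.single i 1 : Fin 4 → ℂ) = x
  rw [← Matrix.mulVec_mulVec, ← Matrix.mulVec_mulVec, hM.2, hN.2, hN'.2, hM.2, hv]
  simp only [Bform_sub_left, Bform_smul_left, Bform_sub_right, Bform_smul_right, hM.1]
  rw [Bform_comm v u]
  ext j
  simp only [Pi.sub_apply, Pi.smul_apply, smul_eq_mul]
  linear_combination (2 * Bform x v * (v j - 2 * Bform u v * u j)) * hε

theorem ι_mul_ι_reflection {u v v' : Fin 4 → ℂ} {ε : ℂ} (hu : Bform u u = 1)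
    (hε : ε * ε = 1) (hv : v' = ε • ((2 * Bform u v) • u - v)) :
    CliffordAlgebra.ι Q4 u * CliffordAlgebra.ι Q4 v
      = ε • (CliffordAlgebra.ι Q4 v' * CliffordAlgebra.ι Q4 u) := by
  have h := CliffordAlgebra.ι_mul_ι_add_swap (Q := Q4) u v
  rw [polar_Q4] at h
  rw [hv, map_smul, map_sub, map_smul, smul_mul_assoc, smul_smul, hε, one_smul, sub_mul,
    smul_mul_assoc, CliffordAlgebra.ι_sq_scalar, Q4_apply, hu, map_one,
    ← Algebra.algebraMap_eq_smul_one, ← h, add_sub_cancel_right]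

theorem Bform_reflection {u v v' x : Fin 4 → ℂ} {ε : ℂ} (hu : Bform u u = 1)
    (hε : ε * ε = 1) (hv : v' = ε • ((2 * Bform u v) • u - v)) :
    Bform x v = -(ε * Bform (x - (2 * Bform x u) • u) v') := by
  rw [hv]
  simp only [Bform_sub_left, Bform_smul_left, Bform_sub_right, Bform_smul_right, hu]
  linear_combination (-Bform x v) * hε

theorem reflection_mul_term {H : Subgroup (GL (Fin 4) ℂ)} {g h h' : H}
    {u v v' : Fin 4 → ℂ} {ε : ℂ} (hg : IsReflection (g : GL (Fin 4) ℂ) u)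
    (hh : IsReflection (h : GL (Fin 4) ℂ) v) (hh' : IsReflection (h' : GL (Fin 4) ℂ) v')
    (hε : ε * ε = 1) (hv : v' = ε • ((2 * Bform u v) • u - v)) (k : ℂ) (x : Fin 4 → ℂ) :
    (MonoidAlgebra.of ℂ H g ⊗ₜ[ℂ] CliffordAlgebra.ι Q4 u)
        * ((k * Bform x v) • (MonoidAlgebra.of ℂ H h ⊗ₜ[ℂ] CliffordAlgebra.ι Q4 v))
      = -(((k * Bform (Matrix.mulVec ((g : GL (Fin 4) ℂ) : Matrix (Fin 4) (Fin 4) ℂ) x) v') •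
          (MonoidAlgebra.of ℂ H h' ⊗ₜ[ℂ] CliffordAlgebra.ι Q4 v'))
        * (MonoidAlgebra.of ℂ H g ⊗ₜ[ℂ] CliffordAlgebra.ι Q4 u)) := by
  have hgh : g * h = h' * g :=
    Subtype.ext (Units.ext (hg.mul_eq hh hh' hε hv))
  rw [mul_smul_comm, smul_mul_assoc, Algebra.TensorProduct.tmul_mul_tmul,
    Algebra.TensorProduct.tmul_mul_tmul, ← map_mul (MonoidAlgebra.of ℂ H),
    ← map_mul (MonoidAlgebra.of ℂ H), hgh,
    ι_mul_ι_reflection hg.1 hε hv, TensorProduct.tmul_smul, smul_smul, hg.2 x]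
  have hk : k * Bform x v * ε = -(k * Bform (x - (2 * Bform x u) • u) v') := by
    rw [Bform_reflection (x := x) hg.1 hε hv]
    linear_combination (-k * Bform (x - (2 * Bform x u) • u) v') * hε
  rw [hk]
  exact neg_smul _ _

/-- The index in `{1, …, m}` congruent to `2 p - r` modulo `m`. -/
def reflIndex (m p r : ℕ) : ℕ :=
  if r < 2 * p then (if 2 * p - r ≤ m then 2 * p - r else 2 * p - r - m) else 2 * p + m - r

theorem reflIndex_mem {m p r : ℕ} (hp : p ∈ Finset.Icc 1 m) (hr : r ∈ Finset.Icc 1 m) :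
    reflIndex m p r ∈ Finset.Icc 1 m := by
  simp only [Finset.mem_Icc, reflIndex] at *
  split_ifs <;> omega

theorem reflIndex_reflIndex {m p r : ℕ} (hp : p ∈ Finset.Icc 1 m) (hr : r ∈ Finset.Icc 1 m) :
    reflIndex m p (reflIndex m p r) = r := by
  simp only [Finset.mem_Icc, reflIndex] at *
  split_ifs <;> omega

theorem reflIndex_add {m p r : ℕ} (hp : p ∈ Finset.Icc 1 m) (hr : r ∈ Finset.Icc 1 m) :
    reflIndex m p r + r = 2 * p ∨ reflIndex m p r + r + m = 2 * p ∨
      reflIndex m p r + r = 2 * p + m := by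
  simp only [Finset.mem_Icc, reflIndex] at *
  split_ifs <;> omega

theorem parity_weight_reflIndex {m p r : ℕ} (hp : p ∈ Finset.Icc 1 m)
    (hr : r ∈ Finset.Icc 1 m) (a b : ℂ) :
    (if Odd m then a else if Odd (reflIndex m p r) then a else b)
      = if Odd m then a else if Odd r then a else b := by
  by_cases hm : Odd m
  · simp [hm]
  · have h : Odd (reflIndex m p r) ↔ Odd r := by
      have := reflIndex_add hp hr
      simp only [Nat.odd_iff] at *
      omega
    simp only [h]

theorem sin_cos_reflIndex {m p r : ℕ} (hp : p ∈ Finset.Icc 1 m) (hr : r ∈ Finset.Icc 1 m) :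
    ∃ ε : ℝ, ε * ε = 1 ∧
      Real.sin (reflIndex m p r * Real.pi / m)
        = ε * Real.sin (2 * (p * Real.pi / m) - r * Real.pi / m) ∧
      Real.cos (reflIndex m p r * Real.pi / m)
        = ε * Real.cos (2 * (p * Real.pi / m) - r * Real.pi / m) := by
  have hm : (m : ℝ) ≠ 0 := by
    have := Finset.mem_Icc.1 hp
    exact_mod_cast (by omega : m ≠ 0)
  rcases reflIndex_add hp hr with h | h | h
  · have h' : (reflIndex m p r : ℝ) = 2 * p - r := by
      rw [eq_sub_iff_add_eq]; exact_mod_cast h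
    have e : (reflIndex m p r * Real.pi / m : ℝ)
        = 2 * (p * Real.pi / m) - r * Real.pi / m := by
      rw [h']; field_simp
    exact ⟨1, by norm_num, by rw [e, one_mul], by rw [e, one_mul]⟩
  · have h' : (reflIndex m p r : ℝ) = 2 * p - m - r := by
      have : (reflIndex m p r + r + m : ℝ) = 2 * p := by exact_mod_cast h
      linarith
    have e : (reflIndex m p r * Real.pi / m : ℝ)
        = 2 * (p * Real.pi / m) - r * Real.pi / m - Real.pi := by
      rw [h']; field_simp; ring
    exact ⟨-1, by norm_num, by rw [e, Real.sin_sub_pi, neg_one_mul],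
      by rw [e, Real.cos_sub_pi, neg_one_mul]⟩
  · have h' : (reflIndex m p r : ℝ) = 2 * p + m - r := by
      rw [eq_sub_iff_add_eq]; exact_mod_cast h
    have e : (reflIndex m p r * Real.pi / m : ℝ)
        = 2 * (p * Real.pi / m) - r * Real.pi / m + Real.pi := by
      rw [h']; field_simp; ring
    exact ⟨-1, by norm_num, by rw [e, Real.sin_add_pi, neg_one_mul],
      by rw [e, Real.cos_add_pi, neg_one_mul]⟩

theorem isReflection_sMat (m p : ℕ) : IsReflection (sMat m p) (αv m p) := by
  have e : (2 * p * Real.pi / m : ℝ) = 2 * (p * Real.pi / m) := by ring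
  have h : ((Real.sin (p * Real.pi / m) : ℝ) : ℂ) ^ 2
      + ((Real.cos (p * Real.pi / m) : ℝ) : ℂ) ^ 2 = 1 := by
    exact_mod_cast Real.sin_sq_add_cos_sq (p * Real.pi / m)
  constructor
  · simp only [Bform, αv, Fin.sum_univ_four, Matrix.cons_val]
    linear_combination h
  · intro x
    simp only [sMat, e, Real.cos_two_mul, Real.sin_two_mul]
    simp only [αv, Bform, Complex.ofReal_sub, Complex.ofReal_mul, Complex.ofReal_pow,
      Complex.ofReal_one, Complex.ofReal_ofNat]
    generalize ((Real.sin (p * Real.pi / m) : ℝ) : ℂ) = S at *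
    generalize ((Real.cos (p * Real.pi / m) : ℝ) : ℂ) = C at *
    ext j
    fin_cases j <;>
      simp only [Matrix.mulVec, dotProduct, Fin.sum_univ_four, Matrix.of_apply, Matrix.cons_val,
        Pi.sub_apply, Pi.smul_apply, smul_eq_mul, Fin.zero_eta, Fin.mk_one, Fin.reduceFinMk]
    · linear_combination (2 * x 0) * h
    · ring
    · ring
    · ring

theorem isReflection_tMat (m q : ℕ) : IsReflection (tMat m q) (βv m q) := by
  have e : (2 * q * Real.pi / m : ℝ) = 2 * (q * Real.pi / m) := by ring
  have h : ((Real.sin (q * Real.pi / m) : ℝ) : ℂ) ^ 2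
      + ((Real.cos (q * Real.pi / m) : ℝ) : ℂ) ^ 2 = 1 := by
    exact_mod_cast Real.sin_sq_add_cos_sq (q * Real.pi / m)
  constructor
  · simp only [Bform, βv, Fin.sum_univ_four, Matrix.cons_val]
    linear_combination h
  · intro x
    simp only [tMat, e, Real.cos_two_mul, Real.sin_two_mul]
    simp only [βv, Bform, Complex.ofReal_sub, Complex.ofReal_mul, Complex.ofReal_pow,
      Complex.ofReal_one, Complex.ofReal_ofNat]
    generalize ((Real.sin (q * Real.pi / m) : ℝ) : ℂ) = S at *
    generalize ((Real.cos (q * Real.pi / m) : ℝ) : ℂ) = C at *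
    ext j
    fin_cases j <;>
      simp only [Matrix.mulVec, dotProduct, Fin.sum_univ_four, Matrix.of_apply, Matrix.cons_val,
        Pi.sub_apply, Pi.smul_apply, smul_eq_mul, Fin.zero_eta, Fin.mk_one, Fin.reduceFinMk]
    · ring
    · ring
    · linear_combination (2 * x 2) * h
    · ring

theorem Bform_αv_βv (m n p q : ℕ) : Bform (αv m p) (βv n q) = 0 := by
  simp [Bform, αv, βv, Fin.sum_univ_four]

theorem αv_reflIndex {m p r : ℕ} (hp : p ∈ Finset.Icc 1 m) (hr : r ∈ Finset.Icc 1 m) :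
    ∃ ε : ℂ, ε * ε = 1 ∧
      αv m (reflIndex m p r) = ε • ((2 * Bform (αv m p) (αv m r)) • αv m p - αv m r) := by
  obtain ⟨ε, hε, hsin, hcos⟩ := sin_cos_reflIndex hp hr
  refine ⟨ε, by exact_mod_cast hε, ?_⟩
  have h := Real.sin_sq_add_cos_sq (p * Real.pi / m)
  rw [Real.sin_sub, Real.sin_two_mul, Real.cos_two_mul] at hsin
  rw [Real.cos_sub, Real.sin_two_mul, Real.cos_two_mul] at hcos
  ext j
  fin_cases j <;>
    simp only [αv, Bform, Fin.sum_univ_four, Matrix.cons_val, Pi.sub_apply, Pi.smul_apply,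
      smul_eq_mul, Fin.zero_eta, Fin.mk_one, Fin.reduceFinMk, mul_zero, sub_zero] <;>
    norm_cast
  · linear_combination hsin + (-2 * ε * Real.sin (r * Real.pi / m)) * h
  · linear_combination -hcos

theorem βv_reflIndex {m p r : ℕ} (hp : p ∈ Finset.Icc 1 m) (hr : r ∈ Finset.Icc 1 m) :
    ∃ ε : ℂ, ε * ε = 1 ∧
      βv m (reflIndex m p r) = ε • ((2 * Bform (βv m p) (βv m r)) • βv m p - βv m r) := by
  obtain ⟨ε, hε, hsin, hcos⟩ := sin_cos_reflIndex hp hr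
  refine ⟨ε, by exact_mod_cast hε, ?_⟩
  have h := Real.sin_sq_add_cos_sq (p * Real.pi / m)
  rw [Real.sin_sub, Real.sin_two_mul, Real.cos_two_mul] at hsin
  rw [Real.cos_sub, Real.sin_two_mul, Real.cos_two_mul] at hcos
  ext j
  fin_cases j <;>
    simp only [βv, Bform, Fin.sum_univ_four, Matrix.cons_val, Pi.sub_apply, Pi.smul_apply,
      smul_eq_mul, Fin.zero_eta, Fin.mk_one, Fin.reduceFinMk, mul_zero, sub_zero] <;>
    norm_cast
  · linear_combination hsin + (-2 * ε * Real.sin (r * Real.pi / m)) * h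
  · linear_combination -hcos

theorem neg_tensor_mul {H : Subgroup (GL (Fin 4) ℂ)} (a b : MonoidAlgebra ℂ H ⊗[ℂ] Cl) :
    -a * b = -(a * b) :=
  neg_mul a b

/-- Multiplying by a reflection permutes, up to sign, the terms of a sum over reflections that is
stable under conjugation by it. -/
theorem reflection_mul_sum {H : Subgroup (GL (Fin 4) ℂ)} {g : H} {u : Fin 4 → ℂ}
    (hg : IsReflection (g : GL (Fin 4) ℂ) u) {S : Finset ℕ} {σ : ℕ → ℕ}
    (hσ : ∀ r ∈ S, σ r ∈ S) (hσσ : ∀ r ∈ S, σ (σ r) = r)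
    {h : ℕ → H} {v : ℕ → Fin 4 → ℂ} (hh : ∀ r, IsReflection (h r : GL (Fin 4) ℂ) (v r))
    (hv : ∀ r ∈ S, ∃ ε : ℂ, ε * ε = 1 ∧ v (σ r) = ε • ((2 * Bform u (v r)) • u - v r))
    {κ : ℕ → ℂ} (hκ : ∀ r ∈ S, κ (σ r) = κ r) (x : Fin 4 → ℂ) :
    (MonoidAlgebra.of ℂ H g ⊗ₜ[ℂ] CliffordAlgebra.ι Q4 u)
        * ∑ r ∈ S, (κ r * Bform x (v r)) •
          (MonoidAlgebra.of ℂ H (h r) ⊗ₜ[ℂ] CliffordAlgebra.ι Q4 (v r))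
      = -((∑ r ∈ S,
          (κ r * Bform (Matrix.mulVec ((g : GL (Fin 4) ℂ) : Matrix (Fin 4) (Fin 4) ℂ) x) (v r)) •
          (MonoidAlgebra.of ℂ H (h r) ⊗ₜ[ℂ] CliffordAlgebra.ι Q4 (v r)))
        * (MonoidAlgebra.of ℂ H g ⊗ₜ[ℂ] CliffordAlgebra.ι Q4 u)) := by
  rw [Finset.mul_sum, Finset.sum_mul, ← Finset.sum_neg_distrib]
  refine Finset.sum_nbij' σ σ hσ hσ hσσ hσσ fun r hr => ?_
  obtain ⟨ε, hε, hvr⟩ := hv r hr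
  rw [hκ r hr]
  exact reflection_mul_term hg (hh r) (hh (σ r)) hε hvr (κ r) x

theorem eq_reflection_of_Bform_eq_zero {u v : Fin 4 → ℂ} (h : Bform u v = 0) :
    ∃ ε : ℂ, ε * ε = 1 ∧ v = ε • ((2 * Bform u v) • u - v) :=
  ⟨-1, by norm_num, by simp [h]⟩

/-- Equivariance of the one-index symmetries: for every `x ∈ ℂ⁴`,
`(s_p ⊗ ι(α_p)) O(x) = −O(s_p x) (s_p ⊗ ι(α_p))` and
`(t_q ⊗ ι(β_q)) O(x) = −O(t_q x) (t_q ⊗ ι(β_q))`. -/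
theorem Osym_equivariance (m1 m2 : ℕ) (h1 : 1 ≤ m1) (h2 : 1 ≤ m2)
    (κ1 κ2 κ3 κ4 : ℂ) (κα κβ : ℕ → ℂ)
    (hκα : ∀ p : ℕ, κα p = if Odd m1 then κ1 else (if Odd p then κ1 else κ2))
    (hκβ : ∀ q : ℕ, κβ q = if Odd m2 then κ3 else (if Odd q then κ3 else κ4))
    (s t : ℕ → (Wgrp m1 m2))
    (hs : ∀ p, ((s p : GL (Fin 4) ℂ) : Matrix (Fin 4) (Fin 4) ℂ) = sMat m1 p)
    (ht : ∀ q, ((t q : GL (Fin 4) ℂ) : Matrix (Fin 4) (Fin 4) ℂ) = tMat m2 q)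
    (x : Fin 4 → ℂ) :
    (∀ p, 1 ≤ p → p ≤ m1 →
      (MonoidAlgebra.of ℂ (Wgrp m1 m2) (s p) ⊗ₜ[ℂ] CliffordAlgebra.ι Q4 (αv m1 p))
          * Osym m1 m2 κα κβ s t x
        = -(Osym m1 m2 κα κβ s t (Matrix.mulVec (sMat m1 p) x))
          * (MonoidAlgebra.of ℂ (Wgrp m1 m2) (s p) ⊗ₜ[ℂ] CliffordAlgebra.ι Q4 (αv m1 p))) ∧
    (∀ q, 1 ≤ q → q ≤ m2 →
      (MonoidAlgebra.of ℂ (Wgrp m1 m2) (t q) ⊗ₜ[ℂ] CliffordAlgebra.ι Q4 (βv m2 q))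
          * Osym m1 m2 κα κβ s t x
        = -(Osym m1 m2 κα κβ s t (Matrix.mulVec (tMat m2 q) x))
          * (MonoidAlgebra.of ℂ (Wgrp m1 m2) (t q) ⊗ₜ[ℂ] CliffordAlgebra.ι Q4 (βv m2 q))) := by
  have hS : ∀ r, IsReflection ((s r : GL (Fin 4) ℂ) : Matrix (Fin 4) (Fin 4) ℂ) (αv m1 r) :=
    fun r => hs r ▸ isReflection_sMat m1 r
  have hT : ∀ r, IsReflection ((t r : GL (Fin 4) ℂ) : Matrix (Fin 4) (Fin 4) ℂ) (βv m2 r) :=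
    fun r => ht r ▸ isReflection_tMat m2 r
  constructor
  · intro p hp1 hpm
    have hp : p ∈ Finset.Icc 1 m1 := Finset.mem_Icc.2 ⟨hp1, hpm⟩
    rw [Osym, Osym, ← hs p, mul_add, neg_tensor_mul, add_mul, neg_add,
      reflection_mul_sum (hS p) (fun r => reflIndex_mem hp) (fun r => reflIndex_reflIndex hp) hS
        (fun r => αv_reflIndex hp)
        (fun r hr => by rw [hκα, hκα, parity_weight_reflIndex hp hr]),
      reflection_mul_sum (hS p) (σ := id) (fun r hr => hr) (fun r _ => rfl) hT
        (fun r _ => eq_reflection_of_Bform_eq_zero (Bform_αv_βv m1 m2 p r)) (fun r _ => rfl)]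
  · intro q hq1 hqm
    have hq : q ∈ Finset.Icc 1 m2 := Finset.mem_Icc.2 ⟨hq1, hqm⟩
    rw [Osym, Osym, ← ht q, mul_add, neg_tensor_mul, add_mul, neg_add,
      reflection_mul_sum (hT q) (fun r => reflIndex_mem hq) (fun r => reflIndex_reflIndex hq) hT
        (fun r => βv_reflIndex hq)
        (fun r hr => by rw [hκβ, hκβ, parity_weight_reflIndex hq hr]),
      reflection_mul_sum (hT q) (σ := id) (fun r hr => hr) (fun r _ => rfl) hS
        (fun r _ => eq_reflection_of_Bform_eq_zero
          ((Bform_comm _ _).trans (Bform_αv_βv m1 m2 r q))) (fun r _ => rfl)]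

end Stmt18
end
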